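/- arXiv:2402.17865 — 2 statements merged into one kernel-verified Lean document; each statement's English description precedes it below -/
import Mathlib

section
/- If a_j ≠ 0 for all 1 ≤ j ≤ p, then for each 1 ≤ i ≤ d the image of the variable t_i in R_a(λ) is a unit, and its inverse is the image of a polynomial in t_i (with coefficients depending only on the tuple a^{(0)}). -/
open MvPolynomial

noncomputable section

/-- Complete homogeneous symmetric function `h_k` of a list of complex numbers. -/
def hcomp : ℕ → List ℂ → ℂ
  | 0, _ => 1
  | _ + 1, [] => 0
  | k + 1, x :: l => x * hcomp k (x :: l) + hcomp (k + 1) l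
  termination_by k l => (l.length, k)

/-- Elementary symmetric polynomial `e_r` in the variables indexed by `J ⊆ {1,…,d}`. -/
def elemSym (d : ℕ) (J : Finset (Fin d)) (r : ℕ) : MvPolynomial (Fin d) ℂ :=
  ∑ s ∈ J.powersetCard r, ∏ j ∈ s, X j

/-- The tuple `a^{(n)}` : entries `a_1,…,a_{λ_i}` for each row `i = n+1,…,ℓ` (0-indexed rows). -/
def aTuple (ℓ : ℕ) (lam : ℕ → ℕ) (a : ℕ → ℂ) (n : ℕ) : List ℂ :=
  ((List.range ℓ).drop n).flatMap fun i => (List.range (lam i)).map a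

/-- `m_λ(n) = λ_{n+1} + … + λ_ℓ` (0-indexed rows `n,…,ℓ-1`). -/
def mRem (ℓ : ℕ) (lam : ℕ → ℕ) (n : ℕ) : ℕ := ∑ i ∈ Finset.Ico n ℓ, lam i

/-- The deformed Tanisaki generator `g_{n,J,r} = Σ_{k=0}^r (−1)^k e_{r−k}(t_J) h_k(a^{(n)})`. -/
def tanGen (d ℓ : ℕ) (lam : ℕ → ℕ) (a : ℕ → ℂ) (n : ℕ) (J : Finset (Fin d)) (r : ℕ) :
    MvPolynomial (Fin d) ℂ :=
  ∑ k ∈ Finset.range (r + 1), C ((-1) ^ k * hcomp k (aTuple ℓ lam a n)) * elemSym d J (r - k)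

/-- The deformed Tanisaki ideal `⟨𝒞^a_λ⟩`. -/
def tanIdeal (d ℓ : ℕ) (lam : ℕ → ℕ) (a : ℕ → ℂ) : Ideal (MvPolynomial (Fin d) ℂ) :=
  Ideal.span {g | ∃ n J r, n < ℓ ∧ J.card = d - n ∧
    d - n - mRem ℓ lam n < r ∧ r ≤ d - n ∧ g = tanGen d ℓ lam a n J r}

/-- `lam 0, lam 1, …, lam (ℓ-1)` is a partition of `d` with `ℓ` positive parts. -/
def IsPartitionOf (d ℓ : ℕ) (lam : ℕ → ℕ) : Prop :=
  0 < ℓ ∧ (∀ i j, i ≤ j → lam j ≤ lam i) ∧ (∀ i < ℓ, 0 < lam i) ∧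
    (∀ i, ℓ ≤ i → lam i = 0) ∧ ∑ i ∈ Finset.range ℓ, lam i = d

/-- `λ^t_i = #{rows j with λ_j ≥ i}` (here `i ≥ 1`). -/
def lamT (ℓ : ℕ) (lam : ℕ → ℕ) (i : ℕ) : ℕ :=
  ((Finset.range ℓ).filter fun j => i ≤ lam j).card

/-- The deformed Tanisaki–Garsia–Procesi algebra `R_a(λ)`. -/
abbrev TGPAlg (d ℓ : ℕ) (lam : ℕ → ℕ) (a : ℕ → ℂ) :=
  MvPolynomial (Fin d) ℂ ⧸ tanIdeal d ℓ lam a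


/-- `∏ (1 + x z)` over a list. -/
def linProd {R : Type} [CommRing R] (l : List R) : Polynomial R :=
  (l.map fun x => 1 + Polynomial.C x * Polynomial.X).prod

lemma linProd_cons {R : Type} [CommRing R] (x : R) (l : List R) :
    linProd (x :: l) = (1 + Polynomial.C x * Polynomial.X) * linProd l := by
  simp [linProd]

lemma linFac_natDegree {R : Type} [CommRing R] (x : R) :
    (1 + Polynomial.C x * Polynomial.X : Polynomial R).natDegree ≤ 1 := by
  compute_degree

lemma linProd_natDegree {R : Type} [CommRing R] (l : List R) :
    (linProd l).natDegree ≤ l.length := by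
  induction l with
  | nil => simp [linProd]
  | cons x l ih =>
    rw [linProd_cons, List.length_cons, add_comm l.length]
    exact Polynomial.natDegree_mul_le.trans (add_le_add (linFac_natDegree x) ih)

lemma linProd_reflect {R : Type} [CommRing R] (l : List R) :
    Polynomial.reflect l.length (linProd l) =
      (l.map fun x => Polynomial.X + Polynomial.C x).prod := by
  induction l with
  | nil => simp [linProd]
  | cons x l ih =>
    rw [linProd_cons, List.length_cons, add_comm,
      Polynomial.reflect_mul _ _ (linFac_natDegree x) (linProd_natDegree l), ih]
    rw [Polynomial.reflect_add, Polynomial.reflect_C_mul, Polynomial.reflect_one]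
    have h := Polynomial.reflect_monomial (R := R) 1 1
    simp only [pow_one, Polynomial.revAt_le le_rfl] at h
    rw [h]
    simp

/-- Signed generating function of the complete homogeneous polynomials. -/
def hSer (R : Type) [CommRing R] [Algebra ℂ R] (l : List ℂ) : PowerSeries R :=
  PowerSeries.mk fun k => algebraMap ℂ R ((-1) ^ k * hcomp k l)

lemma hSer_cons {R : Type} [CommRing R] [Algebra ℂ R] (x : ℂ) (l : List ℂ) :
    (1 + PowerSeries.C (algebraMap ℂ R x) * PowerSeries.X) * hSer R (x :: l) = hSer R l := by
  ext k
  rw [add_mul, one_mul, mul_assoc, map_add, PowerSeries.coeff_C_mul]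
  cases k with
  | zero => simp [hSer, hcomp]
  | succ k =>
    rw [PowerSeries.coeff_succ_X_mul]
    simp only [hSer, PowerSeries.coeff_mk]
    rw [← map_mul, ← map_add]
    congr 1
    rw [hcomp]
    ring

lemma hSer_mul {R : Type} [CommRing R] [Algebra ℂ R] (l : List ℂ) :
    ((linProd (l.map (algebraMap ℂ R)) : Polynomial R) : PowerSeries R) * hSer R l = 1 := by
  induction l with
  | nil =>
    ext k
    cases k <;> simp [linProd, hSer, hcomp, PowerSeries.coeff_one]
  | cons x l ih =>
    rw [List.map_cons, linProd_cons, Polynomial.coe_mul, mul_comm (Polynomial.toPowerSeries _),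
      mul_assoc]
    have := hSer_cons (R := R) x l
    simp only [Polynomial.coe_add, Polynomial.coe_one, Polynomial.coe_mul, Polynomial.coe_C,
      Polynomial.coe_X]
    rw [this, ih]

lemma key_eq {R : Type} [CommRing R] [Algebra ℂ R] (t : List R) (l : List ℂ)
    (hlen : t.length = l.length)
    (h : ∀ r, 0 < r → r ≤ l.length →
      PowerSeries.coeff r (((linProd t : Polynomial R) : PowerSeries R) * hSer R l) = 0)
    (h0 : PowerSeries.coeff 0 (((linProd t : Polynomial R) : PowerSeries R) * hSer R l) = 1) :
    linProd t = linProd (l.map (algebraMap ℂ R)) := by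
  set A := linProd (l.map (algebraMap ℂ R)) with hA
  have hd : (PowerSeries.X : PowerSeries R) ^ (l.length + 1) ∣
      ((linProd t : Polynomial R) : PowerSeries R) * hSer R l - 1 := by
    rw [PowerSeries.X_pow_dvd_iff]
    intro m hm
    rw [map_sub, PowerSeries.coeff_one]
    rcases Nat.eq_zero_or_pos m with rfl | hp
    · simp only [h0]; simp
    · rw [h m hp (by omega), if_neg (by omega), sub_zero]
  have hd2 := hd.mul_right (A : PowerSeries R)
  have e : (((linProd t : Polynomial R) : PowerSeries R) * hSer R l - 1) * (A : PowerSeries R)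
      = (linProd t : PowerSeries R) - (A : PowerSeries R) := by
    have := hSer_mul (R := R) l
    rw [← hA] at this
    linear_combination (linProd t : PowerSeries R) * this
  rw [e, PowerSeries.X_pow_dvd_iff] at hd2
  ext m
  by_cases hm : m < l.length + 1
  · have := hd2 m hm
    rw [map_sub, Polynomial.coeff_coe, Polynomial.coeff_coe] at this
    exact sub_eq_zero.mp this
  · rw [Polynomial.coeff_eq_zero_of_natDegree_lt, Polynomial.coeff_eq_zero_of_natDegree_lt]
    · have := linProd_natDegree (l.map (algebraMap ℂ R))
      rw [List.length_map] at this
      rw [hA]; omega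
    · have := linProd_natDegree t
      omega

lemma key_root {R : Type} [CommRing R] [Algebra ℂ R] (t : List R) (l : List ℂ)
    (hlen : t.length = l.length)
    (h : linProd t = linProd (l.map (algebraMap ℂ R))) (x : R) (hx : x ∈ t) :
    Polynomial.aeval x (l.map fun y => Polynomial.C y - Polynomial.X).prod = 0 := by
  have h1 := linProd_reflect t
  have h2 := linProd_reflect (l.map (algebraMap ℂ R))
  rw [List.length_map, ← hlen, ← h, h1] at h2
  have h3 := congrArg (Polynomial.eval (-x)) h2
  rw [Polynomial.eval_list_prod, Polynomial.eval_list_prod] at h3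
  rw [map_list_prod]
  simp only [List.map_map, Function.comp_def, Polynomial.eval_add, Polynomial.eval_X,
    Polynomial.eval_C, map_sub, Polynomial.aeval_X, Polynomial.aeval_C] at h3 ⊢
  rw [List.prod_eq_zero (l := t.map fun y => -x + y)] at h3
  · rw [h3]
    congr 1
    apply List.map_congr_left
    intro y _
    ring
  · exact List.mem_map.mpr ⟨x, hx, by ring⟩

lemma linProd_coeff {d : ℕ} {R : Type} [CommRing R] (f : MvPolynomial (Fin d) ℂ →+* R) (r : ℕ) :
    (linProd ((List.finRange d).map fun i => f (X i))).coeff r =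
      f (elemSym d Finset.univ r) := by
  have : linProd ((List.finRange d).map fun i => f (X i)) =
      ∏ i : Fin d, (1 + Polynomial.C (f (X i)) * Polynomial.X) := by
    rw [linProd, List.map_map, ← List.ofFn_eq_map, List.prod_ofFn]
    rfl
  rw [this, Finset.prod_one_add, elemSym, map_sum, Polynomial.finsetSum_coeff,
    Finset.powersetCard_eq_filter, Finset.sum_filter]
  apply Finset.sum_congr rfl
  intro s _
  rw [Finset.prod_mul_distrib, Finset.prod_const, ← map_prod, Polynomial.coeff_C_mul,
    Polynomial.coeff_X_pow, map_prod]
  simp [eq_comm]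

lemma aTuple_length (ℓ : ℕ) (lam : ℕ → ℕ) (a : ℕ → ℂ) :
    (aTuple ℓ lam a 0).length = ∑ i ∈ Finset.range ℓ, lam i := by
  rw [aTuple, List.drop_zero, List.length_flatMap]
  simp only [List.length_map, List.length_range]
  induction ℓ with
  | zero => simp
  | succ n ih => rw [List.range_succ, List.map_append, List.sum_append, ih, Finset.sum_range_succ]; simp

lemma inv_poly (P : Polynomial ℂ) (hP : P.eval 0 ≠ 0) : ∃ q : Polynomial ℂ,
    ∃ c : Polynomial ℂ, Polynomial.X * q = 1 + c * P := by
  refine ⟨-Polynomial.C (P.eval 0)⁻¹ * P.divX, -Polynomial.C (P.eval 0)⁻¹, ?_⟩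
  have h := Polynomial.divX_mul_X_add P
  rw [Polynomial.coeff_zero_eq_eval_zero] at h
  have h2 : Polynomial.C (P.eval 0)⁻¹ * Polynomial.C (P.eval 0) = 1 := by
    rw [← map_mul, inv_mul_cancel₀ hP, map_one]
  linear_combination (-Polynomial.C (P.eval 0)⁻¹) * h + h2

/-- if all `a_j ≠ 0`, then each `t_i` is a unit in `R_a(λ)`, with inverse
the image of a (single, depending only on `a^{(0)}`) polynomial evaluated at `t_i`. -/
theorem deformed_TGP_t_invertible (d ℓ : ℕ) (lam : ℕ → ℕ) (hpart : IsPartitionOf d ℓ lam)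
    (a : ℕ → ℂ) (ha0 : ∀ j, j < lam 0 → a j ≠ 0) :
    (∀ i : Fin d, IsUnit (Ideal.Quotient.mk (tanIdeal d ℓ lam a) (X i))) ∧
    ∃ q : Polynomial ℂ, ∀ i : Fin d,
      Ideal.Quotient.mk (tanIdeal d ℓ lam a) (X i) *
        Ideal.Quotient.mk (tanIdeal d ℓ lam a) (Polynomial.aeval (X i) q) = 1 := by
  obtain ⟨hℓ, hmono, hpos, hzero, hsum⟩ := hpart
  have hlen : (aTuple ℓ lam a 0).length = d := by rw [aTuple_length, hsum]
  suffices hq : ∃ q : Polynomial ℂ, ∀ i : Fin d,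
      Ideal.Quotient.mk (tanIdeal d ℓ lam a) (X i) *
        Ideal.Quotient.mk (tanIdeal d ℓ lam a) (Polynomial.aeval (X i) q) = 1 by
    refine ⟨fun i => ?_, hq⟩
    obtain ⟨q, hq⟩ := hq
    exact IsUnit.of_mul_eq_one _ (hq i)
  set l := aTuple ℓ lam a 0 with hl
  set f := Ideal.Quotient.mk (tanIdeal d ℓ lam a) with hf
  have hne : ∀ y ∈ l, y ≠ 0 := by
    intro y hy
    rw [hl, aTuple, List.drop_zero, List.mem_flatMap] at hy
    obtain ⟨i, _, hy⟩ := hy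
    obtain ⟨j, hj, rfl⟩ := List.mem_map.mp hy
    exact ha0 j (lt_of_lt_of_le (List.mem_range.mp hj) (hmono 0 i (Nat.zero_le i)))
  have hcoeff : ∀ r, PowerSeries.coeff r
      (((linProd ((List.finRange d).map fun i => f (X i)) : Polynomial _) : PowerSeries _) *
        hSer (TGPAlg d ℓ lam a) l) = f (tanGen d ℓ lam a 0 Finset.univ r) := by
    intro r
    rw [mul_comm, PowerSeries.coeff_mul, Finset.Nat.sum_antidiagonal_eq_sum_range_succ_mk, tanGen,
      map_sum]
    apply Finset.sum_congr rfl
    intro k _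
    rw [Polynomial.coeff_coe, linProd_coeff, hSer, PowerSeries.coeff_mk, map_mul f]
    rfl
  have hE := key_eq ((List.finRange d).map fun i => f (X i)) l (by simp [hlen])
    (by
      intro r hr hr2
      rw [hcoeff, hf, Ideal.Quotient.eq_zero_iff_mem]
      apply Ideal.subset_span
      refine ⟨0, Finset.univ, r, hℓ, by simp, ?_, by omega, rfl⟩
      have : mRem ℓ lam 0 = d := by rw [mRem, ← hsum, Finset.range_eq_Ico]
      omega)
    (by
      rw [hcoeff]
      simp [tanGen, elemSym, hcomp])
  have hroot := key_root ((List.finRange d).map fun i => f (X i)) l (by simp [hlen]) hE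
  obtain ⟨q, c, hqc⟩ := inv_poly (l.map fun y => Polynomial.C y - Polynomial.X).prod (by
    rw [Polynomial.eval_list_prod]
    apply List.prod_ne_zero
    simp only [List.map_map, List.mem_map, Function.comp_def, Polynomial.eval_sub,
      Polynomial.eval_C, Polynomial.eval_X, sub_zero]
    rintro ⟨y, hy, h0⟩
    exact hne y hy h0)
  refine ⟨q, fun i => ?_⟩
  have h1 := hroot (f (X i)) (List.mem_map.mpr ⟨i, List.mem_finRange i, rfl⟩)
  have h2 := congrArg (Polynomial.aeval (f (X i))) hqc
  rw [map_mul, map_add, map_mul, h1, mul_zero, add_zero, Polynomial.aeval_X, map_one] at h2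
  have h3 : f (Polynomial.aeval (X i) q) = Polynomial.aeval (f (X i)) q :=
    (Polynomial.aeval_algHom_apply (Ideal.Quotient.mkₐ ℂ (tanIdeal d ℓ lam a)) (X i) q).symm
  rw [h3, h2]

end
end

section
/- Let a ∈ ℂ and take all evaluation parameters equal: a = (a, a, …, a) ∈ ℂ^p. Then the subspace of S_d-invariant elements of R_a(λ) (under the ℂ-linear action induced by permuting the variables t_1, …, t_d) is one-dimensional, spanned by the image of the constant polynomial 1. -/
open MvPolynomial

noncomputable section

theorem hcomp_series (l : List ℂ) :
    (PowerSeries.mk fun k => (-1) ^ k * hcomp k l) *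
      (l.map fun x => (1 + PowerSeries.C x * PowerSeries.X : PowerSeries ℂ)).prod = 1 := by
  induction l with
  | nil =>
    ext k
    cases k with
    | zero => simp [hcomp]
    | succ k => simp [hcomp, PowerSeries.coeff_one]
  | cons x l ih =>
    rw [List.map_cons, List.prod_cons, ← mul_assoc]
    refine Eq.trans ?_ ih
    congr 1
    ext k
    rw [mul_add, mul_one, map_add, ← mul_assoc]
    cases k with
    | zero => simp [hcomp]
    | succ k =>
      rw [PowerSeries.coeff_succ_mul_X, PowerSeries.coeff_mul_C]
      simp only [PowerSeries.coeff_mk]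
      rw [hcomp]
      ring

theorem aTuple_const (ℓ : ℕ) (lam : ℕ → ℕ) (a : ℂ) (n : ℕ) :
    aTuple ℓ lam (fun _ => a) n = List.replicate (mRem ℓ lam n) a := by
  rw [List.eq_replicate_iff]
  constructor
  · have h : (List.range ℓ).drop n = List.Ico n ℓ := by
      rw [List.Ico, List.range_eq_range', List.drop_range']
      simp
    unfold aTuple mRem
    rw [h, List.length_flatMap, Finset.sum]
    simp [Finset.Ico, LocallyFiniteOrder.finsetIcc, List.Ico]
    try rfl
  · intro b hb
    unfold aTuple at hb
    simp at hb
    grind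

theorem eval_elemSym (d : ℕ) (J : Finset (Fin d)) (r : ℕ) (a : ℂ) :
    eval (fun _ => a) (elemSym d J r) = (J.card.choose r : ℂ) * a ^ r := by
  unfold elemSym
  rw [map_sum, Finset.sum_congr rfl (g := fun _ => a ^ r)]
  · simp
  · intro s hs
    rw [Finset.mem_powersetCard] at hs
    simp [hs.2]

theorem coeff_pow_lin (a : ℂ) (N r : ℕ) :
    PowerSeries.coeff r ((1 + PowerSeries.C a * PowerSeries.X : PowerSeries ℂ) ^ N) =
      (N.choose r : ℂ) * a ^ r := by
  have h : (1 + PowerSeries.C a * PowerSeries.X : PowerSeries ℂ) ^ N =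
      PowerSeries.rescale a ((1 + PowerSeries.X) ^ N) := by
    simp [PowerSeries.rescale_X]
  rw [h, PowerSeries.coeff_rescale]
  have h2 : ((1 + PowerSeries.X : PowerSeries ℂ) ^ N) =
      (((1 + Polynomial.X) ^ N : Polynomial ℂ) : PowerSeries ℂ) := by simp
  rw [h2, Polynomial.coeff_coe, Polynomial.coeff_one_add_X_pow, mul_comm]

theorem eval_tanGen (d ℓ : ℕ) (lam : ℕ → ℕ) (a : ℂ) (n : ℕ) (J : Finset (Fin d)) (r : ℕ)
    (hJ : mRem ℓ lam n ≤ J.card) (hr : J.card - mRem ℓ lam n < r) :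
    eval (fun _ => a) (tanGen d ℓ lam (fun _ => a) n J r) = 0 := by
  have h1 : eval (fun _ => a) (tanGen d ℓ lam (fun _ => a) n J r) =
      PowerSeries.coeff r ((PowerSeries.mk fun k =>
        (-1) ^ k * hcomp k (aTuple ℓ lam (fun _ => a) n)) *
        (1 + PowerSeries.C a * PowerSeries.X : PowerSeries ℂ) ^ J.card) := by
    rw [PowerSeries.coeff_mul, Finset.Nat.sum_antidiagonal_eq_sum_range_succ_mk]
    unfold tanGen
    rw [map_sum]
    refine Finset.sum_congr rfl fun k _ => ?_
    rw [map_mul, eval_C, eval_elemSym, PowerSeries.coeff_mk, coeff_pow_lin]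
  have h2 := hcomp_series (aTuple ℓ lam (fun _ => a) n)
  rw [aTuple_const, List.map_replicate, List.prod_replicate] at h2
  rw [h1, aTuple_const]
  obtain ⟨q, hq⟩ := Nat.exists_eq_add_of_le hJ
  rw [hq, pow_add, ← mul_assoc, h2, one_mul, coeff_pow_lin, Nat.choose_eq_zero_of_lt (by omega)]
  simp

theorem mRem_le (d ℓ : ℕ) (lam : ℕ → ℕ) (hpart : IsPartitionOf d ℓ lam) (n : ℕ) (hn : n < ℓ) :
    mRem ℓ lam n ≤ d - n := by
  obtain ⟨_, _, hpos, _, hsum⟩ := hpart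
  have h := Finset.sum_range_add_sum_Ico lam hn.le
  have h2 : n ≤ ∑ i ∈ Finset.range n, lam i := by
    calc n = ∑ i ∈ Finset.range n, 1 := by simp
      _ ≤ _ := Finset.sum_le_sum fun i hi => hpos i (by
        rw [Finset.mem_range] at hi; omega)
  unfold mRem
  omega

theorem tanIdeal_le_ker (d ℓ : ℕ) (lam : ℕ → ℕ) (hpart : IsPartitionOf d ℓ lam) (a : ℂ) :
    tanIdeal d ℓ lam (fun _ => a) ≤
      RingHom.ker (eval (fun _ => a) : MvPolynomial (Fin d) ℂ →+* ℂ) := by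
  unfold tanIdeal
  rw [Ideal.span_le]
  rintro g ⟨n, J, r, hn, hJ, hr, _, rfl⟩
  have := mRem_le d ℓ lam hpart n hn
  exact eval_tanGen d ℓ lam a n J r (by omega) (by omega)

theorem rename_elemSym (d : ℕ) (J : Finset (Fin d)) (r : ℕ) (σ : Equiv.Perm (Fin d)) :
    rename σ (elemSym d J r) = elemSym d (J.map σ.toEmbedding) r := by
  unfold elemSym
  rw [Finset.powersetCard_map, map_sum, Finset.sum_map]
  refine Finset.sum_congr rfl fun s _ => ?_
  simp [Finset.mapEmbedding_apply]

theorem rename_tanIdeal (d ℓ : ℕ) (lam : ℕ → ℕ) (a : ℕ → ℂ) (σ : Equiv.Perm (Fin d)) :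
    tanIdeal d ℓ lam a ≤ (tanIdeal d ℓ lam a).comap
      (rename σ : MvPolynomial (Fin d) ℂ →ₐ[ℂ] MvPolynomial (Fin d) ℂ) := by
  conv_lhs => unfold tanIdeal
  rw [Ideal.span_le]
  rintro g ⟨n, J, r, hn, hJ, hr, hr', rfl⟩
  refine Ideal.subset_span ⟨n, J.map σ.toEmbedding, r, hn, by simpa using hJ, hr, hr', ?_⟩
  unfold tanGen
  rw [map_sum]
  refine Finset.sum_congr rfl fun k _ => ?_
  rw [map_mul, ← rename_elemSym]
  simp

theorem elemSym_const (d ℓ : ℕ) (lam : ℕ → ℕ) (hpart : IsPartitionOf d ℓ lam) (a : ℕ → ℂ)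
    (r : ℕ) (hr : r ≤ d) :
    ∃ c : ℂ, Ideal.Quotient.mk (tanIdeal d ℓ lam a) (elemSym d Finset.univ r) =
      Ideal.Quotient.mk (tanIdeal d ℓ lam a) (C c) := by
  induction r using Nat.strong_induction_on with
  | _ r ih =>
    rcases Nat.eq_zero_or_pos r with rfl | hpos
    · exact ⟨1, by simp [elemSym]⟩
    have hm : mRem ℓ lam 0 = d := by
      unfold mRem
      rw [← Finset.range_eq_Ico]
      exact hpart.2.2.2.2
    have hg : tanGen d ℓ lam a 0 Finset.univ r ∈ tanIdeal d ℓ lam a :=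
      Ideal.subset_span ⟨0, Finset.univ, r, hpart.1, by simp, by omega, by omega, rfl⟩
    rw [← Ideal.Quotient.eq_zero_iff_mem, tanGen, Finset.sum_range_succ', map_add, map_sum] at hg
    have ih' : ∀ k : ℕ, ∃ c : ℂ, k < r →
        Ideal.Quotient.mk (tanIdeal d ℓ lam a) (elemSym d Finset.univ k) =
        Ideal.Quotient.mk (tanIdeal d ℓ lam a) (C c) := by
      intro k
      by_cases hk : k < r
      · obtain ⟨c, hc⟩ := ih k hk (by omega)
        exact ⟨c, fun _ => hc⟩
      · exact ⟨0, fun h => absurd h hk⟩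
    choose c hc using ih'
    refine ⟨-∑ k ∈ Finset.range r,
      ((-1) ^ (k + 1) * hcomp (k + 1) (aTuple ℓ lam a 0)) * c (r - (k + 1)), ?_⟩
    rw [Finset.sum_congr rfl (g := fun k => Ideal.Quotient.mk (tanIdeal d ℓ lam a)
      (C (((-1) ^ (k + 1) * hcomp (k + 1) (aTuple ℓ lam a 0)) * c (r - (k + 1)))))] at hg
    · have h0 : C ((-1 : ℂ) ^ 0 * hcomp 0 (aTuple ℓ lam a 0)) * elemSym d Finset.univ (r - 0) =
          elemSym d Finset.univ r := by simp [hcomp]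
      rw [h0] at hg
      rw [eq_neg_of_add_eq_zero_right hg, ← map_sum, ← map_sum, ← map_neg, ← map_neg]
    · intro k hk
      rw [map_mul, hc _ (by omega), ← map_mul, ← map_mul]

theorem symm_const (d ℓ : ℕ) (lam : ℕ → ℕ) (hpart : IsPartitionOf d ℓ lam) (a : ℕ → ℂ)
    (f : MvPolynomial (Fin d) ℂ) (hf : f.IsSymmetric) :
    ∃ c : ℂ, Ideal.Quotient.mk (tanIdeal d ℓ lam a) f =
      Ideal.Quotient.mk (tanIdeal d ℓ lam a) (C c) := by
  obtain ⟨q, hq⟩ := (esymmAlgEquiv (Fin d) ℂ (n := d) (by simp)).surjective ⟨f, hf⟩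
  have hq' : aeval (fun i : Fin d => esymm (Fin d) ℂ (i + 1)) q = f := by
    have := congrArg Subtype.val hq
    rw [esymmAlgEquiv_apply] at this
    rw [← esymmAlgHom_apply]
    exact this
  rw [← hq']
  clear hq hq'
  induction q using MvPolynomial.induction_on with
  | C x => exact ⟨x, by simp [algebraMap_eq]⟩
  | add p q hp hq =>
    obtain ⟨x, hx⟩ := hp
    obtain ⟨y, hy⟩ := hq
    exact ⟨x + y, by rw [map_add, map_add, hx, hy, ← map_add, ← map_add]⟩
  | mul_X p i hp =>
    obtain ⟨x, hx⟩ := hp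
    obtain ⟨y, hy⟩ := elemSym_const d ℓ lam hpart a (i + 1) i.2
    refine ⟨x * y, ?_⟩
    rw [map_mul, map_mul, hx, aeval_X]
    have : esymm (Fin d) ℂ (i + 1) = elemSym d Finset.univ (i + 1) := rfl
    rw [this, hy, ← map_mul, ← map_mul]

/-- for a single evaluation parameter `a = (a,…,a)`, the space of
`S_d`-invariants of `R_a(λ)` is one-dimensional, spanned by the image of `1`. -/
theorem deformed_TGP_invariants (d ℓ : ℕ) (lam : ℕ → ℕ) (hpart : IsPartitionOf d ℓ lam)
    (a : ℂ) :
    (Ideal.Quotient.mk (tanIdeal d ℓ lam fun _ => a) 1 ≠ 0) ∧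
    ∀ v : TGPAlg d ℓ lam (fun _ => a),
      ((∀ σ : Equiv.Perm (Fin d),
          ∀ F : TGPAlg d ℓ lam (fun _ => a) →ₗ[ℂ] TGPAlg d ℓ lam (fun _ => a),
          (∀ g : MvPolynomial (Fin d) ℂ,
            F (Ideal.Quotient.mk (tanIdeal d ℓ lam fun _ => a) g) =
              Ideal.Quotient.mk (tanIdeal d ℓ lam fun _ => a) (rename σ g)) →
          F v = v) ↔
        ∃ c : ℂ, v = c • Ideal.Quotient.mk (tanIdeal d ℓ lam fun _ => a) 1) := by
  refine ⟨?_, fun v => ⟨fun hv => ?_, ?_⟩⟩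
  · intro h
    rw [Ideal.Quotient.eq_zero_iff_mem] at h
    have := tanIdeal_le_ker d ℓ lam hpart a h
    simp [RingHom.mem_ker] at this
  · obtain ⟨f, rfl⟩ := Ideal.Quotient.mk_surjective v
    have hinv : ∀ σ : Equiv.Perm (Fin d), Ideal.Quotient.mk (tanIdeal d ℓ lam fun _ => a)
        (rename σ f) = Ideal.Quotient.mk (tanIdeal d ℓ lam fun _ => a) f := by
      intro σ
      have key := hv σ (Ideal.quotientMapₐ (tanIdeal d ℓ lam fun _ => a)
        (rename σ : MvPolynomial (Fin d) ℂ →ₐ[ℂ] MvPolynomial (Fin d) ℂ)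
        (rename_tanIdeal d ℓ lam (fun _ => a) σ)).toLinearMap (fun g => rfl)
      exact key
    have hsym : (∑ σ : Equiv.Perm (Fin d), rename σ f).IsSymmetric := by
      intro τ
      rw [map_sum]
      refine Fintype.sum_equiv (Equiv.mulLeft τ) _ _ fun σ => ?_
      rw [rename_rename]
      rfl
    obtain ⟨c, hc⟩ := symm_const d ℓ lam hpart (fun _ => a) _ hsym
    rw [map_sum, Finset.sum_congr rfl (fun σ _ => hinv σ), Finset.sum_const] at hc
    have hN : ((Finset.univ : Finset (Equiv.Perm (Fin d))).card : ℂ) ≠ 0 := by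
      simp [Fintype.card_perm, Nat.factorial_ne_zero]
    refine ⟨((Finset.univ : Finset (Equiv.Perm (Fin d))).card : ℂ)⁻¹ * c, ?_⟩
    have hC : Ideal.Quotient.mk (tanIdeal d ℓ lam fun _ => a) (C c) =
        c • Ideal.Quotient.mk (tanIdeal d ℓ lam fun _ => a) 1 := by
      rw [← mul_one (C c), ← smul_eq_C_mul]
      rfl
    rw [mul_smul, ← hC, ← hc, ← Nat.cast_smul_eq_nsmul ℂ, smul_smul, inv_mul_cancel₀ hN, one_smul]
  · rintro ⟨c, rfl⟩ σ F hF
    rw [map_smul, hF, map_one]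

end
end
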